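/- Let G be a weighted graph in which every edge e satisfies R_e(G)·c_e ≥ δ for δ > 0. Then the arboricity of G is at most 2/δ: its edges can be partitioned into at most ⌈2/δ⌉ forests. -/

import Mathlib

open Matrix

/-- `P` is the Moore–Penrose pseudoinverse of `A`: the four Penrose conditions. -/
def IsMoorePenrose {V : Type*} [Fintype V] [DecidableEq V]
    (A P : Matrix V V ℝ) : Prop :=
  A * P * A = A ∧ P * A * P = P ∧ (A * P)ᵀ = A * P ∧ (P * A)ᵀ = P * A

/-- The weighted graph Laplacian of a weight function `c`. -/
def Lap {V : Type*} [Fintype V] [DecidableEq V] (c : V → V → ℝ) : Matrix V V ℝ :=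
  Matrix.of fun i j => if i = j then ∑ k, c i k else -(c i j)

/-- The signed incidence vector of the pair `(i, j)`. -/
def chi {V : Type*} [DecidableEq V] (i j : V) : V → ℝ :=
  fun k => if k = i then 1 else if k = j then -1 else 0

/-- The edge set of `G` decomposes into at most `k` forests. -/
def DecomposesIntoForests {V : Type*} (G : SimpleGraph V) (k : ℕ) : Prop :=
  ∃ f : Sym2 V → Fin k,
    ∀ i : Fin k, (SimpleGraph.fromEdgeSet {e | e ∈ G.edgeSet ∧ f e = i}).IsAcyclic

lemma aux_lap_sum {V : Type*} [Fintype V] [DecidableEq V] (c : V → V → ℝ)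
    (hsymm : ∀ i j, c i j = c j i) (hd : ∀ i, c i i = 0) (M : V → V → ℝ) :
    ∑ i, ∑ j, Lap c i j * M i j =
      (1 / 2) * ∑ i, ∑ j, c i j * (M i i + M j j - M i j - M j i) := by
  have h1 : ∑ i, ∑ j, Lap c i j * M i j
      = ∑ i, ∑ j, c i j * M i i - ∑ i, ∑ j, c i j * M i j := by
    rw [← Finset.sum_sub_distrib]
    refine Finset.sum_congr rfl fun i _ => ?_
    have : ∀ j, Lap c i j * M i j
        = (if i = j then (∑ k, c i k) * M i i else 0) - c i j * M i j := by
      intro j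
      by_cases h : i = j
      · subst h; simp [Lap, hd]
      · simp [Lap, h]
    simp only [this, Finset.sum_sub_distrib, Finset.sum_ite_eq, Finset.mem_univ, if_true,
      Finset.sum_mul]
  have h2 : ∑ i, ∑ j, c i j * M j j = ∑ i, ∑ j, c i j * M i i := by
    rw [Finset.sum_comm]
    exact Finset.sum_congr rfl fun i _ => Finset.sum_congr rfl fun j _ => by rw [hsymm]
  have h3 : ∑ i, ∑ j, c i j * M j i = ∑ i, ∑ j, c i j * M i j := by
    rw [Finset.sum_comm]
    exact Finset.sum_congr rfl fun i _ => Finset.sum_congr rfl fun j _ => by rw [hsymm]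
  rw [h1]
  simp only [mul_add, mul_sub, Finset.sum_add_distrib, Finset.sum_sub_distrib]
  rw [h2, h3]; ring

lemma aux_quad {V : Type*} [Fintype V] [DecidableEq V] (c : V → V → ℝ)
    (hsymm : ∀ i j, c i j = c j i) (hd : ∀ i, c i i = 0) (x : V → ℝ) :
    x ⬝ᵥ (Lap c *ᵥ x) = (1 / 2) * ∑ i, ∑ j, c i j * (x i - x j) ^ 2 := by
  have := aux_lap_sum c hsymm hd (fun i j => x i * x j)
  calc x ⬝ᵥ (Lap c *ᵥ x) = ∑ i, ∑ j, Lap c i j * (x i * x j) := by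
        simp only [dotProduct, mulVec, Finset.mul_sum]
        exact Finset.sum_congr rfl fun i _ => Finset.sum_congr rfl fun j _ => by ring
    _ = _ := by
        rw [this]; congr 1
        exact Finset.sum_congr rfl fun i _ => Finset.sum_congr rfl fun j _ => by ring

lemma aux_lap_symm {V : Type*} [Fintype V] [DecidableEq V] (c : V → V → ℝ)
    (hsymm : ∀ i j, c i j = c j i) : (Lap c)ᵀ = Lap c := by
  ext i j
  by_cases h : i = j
  · subst h; rfl
  · simp [Lap, h, Ne.symm h, hsymm i j]

lemma aux_lap_psd {V : Type*} [Fintype V] [DecidableEq V] (c : V → V → ℝ)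
    (hsymm : ∀ i j, c i j = c j i) (hd : ∀ i, c i i = 0) (hn : ∀ i j, 0 ≤ c i j) :
    (Lap c).PosSemidef := by
  refine .of_dotProduct_mulVec_nonneg ?_ fun x => ?_
  · rw [Matrix.IsHermitian, conjTranspose_eq_transpose_of_trivial, aux_lap_symm c hsymm]
  · rw [star_trivial, aux_quad c hsymm hd]
    exact mul_nonneg (by norm_num) (Finset.sum_nonneg fun i _ => Finset.sum_nonneg fun j _ =>
      mul_nonneg (hn i j) (sq_nonneg _))

lemma aux_mp_symm {V : Type*} [Fintype V] [DecidableEq V] (A P : Matrix V V ℝ)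
    (hA : Aᵀ = A) (hP : IsMoorePenrose A P) : Pᵀ = P := by
  obtain ⟨h1, h2, h3, h4⟩ := hP
  rw [transpose_mul, hA] at h3 h4
  -- h3 : Pᵀ A = A P,  h4 : A Pᵀ = P A
  have t1 : A * Pᵀ * A = A := by
    have := congrArg transpose h1
    simpa [transpose_mul, hA, Matrix.mul_assoc] using this
  have t2 : Pᵀ * A * Pᵀ = Pᵀ := by
    have := congrArg transpose h2
    simpa [transpose_mul, hA, Matrix.mul_assoc] using this
  have e1 : P * A = Pᵀ * A := by
    have a : P * A = (P * A) * (Pᵀ * A) := by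
      conv_lhs => rw [← t1]
      simp only [Matrix.mul_assoc]
    have b := congrArg transpose a
    rw [transpose_mul, transpose_mul (P * A), transpose_mul, transpose_mul, hA,
      transpose_transpose, h4, ← h3] at b
    rw [b, Matrix.mul_assoc, ← Matrix.mul_assoc A P A, h1]
  have e2 : A * P = A * Pᵀ := by rw [← h3, h4, e1]
  calc Pᵀ = Pᵀ * A * Pᵀ := t2.symm
    _ = P * A * P := by rw [← e1, Matrix.mul_assoc, ← e2, Matrix.mul_assoc]
    _ = P := h2

lemma aux_psd_fact {n : Type*} [Fintype n] [DecidableEq n] (A : Matrix n n ℝ)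
    (hA : A.PosSemidef) : ∃ B : Matrix n n ℝ, A = Bᵀ * B := by
  open scoped MatrixOrder in
  obtain ⟨B, hB⟩ := CStarAlgebra.nonneg_iff_eq_star_mul_self.mp hA.nonneg
  exact ⟨B, by rw [hB, star_eq_conjTranspose, conjTranspose_eq_transpose_of_trivial]⟩

lemma aux_trace {n : Type*} [Fintype n] [DecidableEq n] (A Q : Matrix n n ℝ)
    (hA : A.PosSemidef) (hQ : Q.PosSemidef) (h : (Q - Q * A * Q).PosSemidef) :
    (A * Q).trace ≤ Fintype.card n := by
  obtain ⟨C, hC⟩ := aux_psd_fact A hA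
  obtain ⟨S, hS⟩ := aux_psd_fact Q hQ
  have k1 : 0 ≤ (A * (Q - Q * A * Q)).trace := by
    have := (h.mul_mul_conjTranspose_same C).trace_nonneg
    rw [conjTranspose_eq_transpose_of_trivial, Matrix.trace_mul_comm, ← Matrix.mul_assoc, ← hC]
      at this
    exact this
  have hAt : Aᵀ = A := by rw [hC, transpose_mul, transpose_transpose]
  have k2 : 0 ≤ ((1 - S * A * Sᵀ) * (1 - S * A * Sᵀ)).trace := by
    have := (posSemidef_self_mul_conjTranspose (1 - S * A * Sᵀ)).trace_nonneg
    rw [conjTranspose_eq_transpose_of_trivial] at this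
    simpa [transpose_mul, hAt, Matrix.mul_assoc] using this
  have e1 : (S * A * Sᵀ).trace = (A * Q).trace := by
    rw [hS, Matrix.mul_assoc, Matrix.trace_mul_comm, Matrix.mul_assoc]
  have e2 : (S * A * Sᵀ * (S * A * Sᵀ)).trace = (A * (Q * A * Q)).trace := by
    rw [hS, show S * A * Sᵀ * (S * A * Sᵀ) = S * (A * Sᵀ * (S * A * Sᵀ)) by
      simp only [Matrix.mul_assoc], Matrix.trace_mul_comm]
    simp only [Matrix.mul_assoc]
  have e3 : (1 - S * A * Sᵀ) * (1 - S * A * Sᵀ)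
      = 1 - S * A * Sᵀ - S * A * Sᵀ + S * A * Sᵀ * (S * A * Sᵀ) := by noncomm_ring
  rw [e3, trace_add, trace_sub, trace_sub, e1, e2, trace_one] at k2
  rw [Matrix.mul_sub, trace_sub] at k1
  linarith

lemma aux_chi {V : Type*} [Fintype V] [DecidableEq V] (P : Matrix V V ℝ) {i j : V} (h : i ≠ j) :
    chi i j ⬝ᵥ P *ᵥ chi i j = P i i + P j j - P i j - P j i := by
  have : chi i j = Pi.single i (1 : ℝ) - Pi.single j 1 := by
    ext k
    simp only [chi, Pi.sub_apply, Pi.single_apply]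
    by_cases h1 : k = i
    · subst h1; simp [h]
    · simp [h1]; split_ifs <;> simp
  rw [this]
  simp [mulVec_sub, sub_dotProduct, dotProduct_sub]
  ring

lemma aux_foster {V : Type*} [Fintype V] [DecidableEq V] (c : V → V → ℝ)
    (hsymm : ∀ i j, c i j = c j i) (hd : ∀ i, c i i = 0) (hn : ∀ i j, 0 ≤ c i j)
    (P : Matrix V V ℝ) (hP : IsMoorePenrose (Lap c) P) (U : Finset V) :
    ∑ i ∈ U, ∑ j ∈ U, c i j * (P i i + P j j - P i j - P j i) ≤ 2 * (U.card : ℝ) := by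
  have hL := aux_lap_symm c hsymm
  have hPt := aux_mp_symm _ P hL hP
  have hLp := aux_lap_psd c hsymm hd hn
  have hPLP := hP.2.1
  have hPp : P.PosSemidef := by
    have := hLp.conjTranspose_mul_mul_same P
    rwa [conjTranspose_eq_transpose_of_trivial, hPt, hPLP] at this
  let c' : U → U → ℝ := fun i j => c i j
  let Q : Matrix U U ℝ := P.submatrix Subtype.val Subtype.val
  have hQ : Q.PosSemidef := hPp.submatrix _
  have hAp : (Lap c').PosSemidef :=
    aux_lap_psd c' (fun i j => hsymm i j) (fun i => hd i) (fun i j => hn i j)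
  have hQt : Qᵀ = Q := by
    ext i j
    exact congrFun (congrFun hPt i.1) j.1
  have key : (Q - Q * Lap c' * Q).PosSemidef := by
    refine .of_dotProduct_mulVec_nonneg ?_ fun x => ?_
    · rw [Matrix.IsHermitian, conjTranspose_eq_transpose_of_trivial, transpose_sub,
        transpose_mul, transpose_mul, hQt, aux_lap_symm c' (fun i j => hsymm i j),
        Matrix.mul_assoc]
    · rw [star_trivial]
      let X : V → ℝ := fun v => if h : v ∈ U then x ⟨v, h⟩ else 0
      have hX : ∀ f : V → ℝ, ∑ v, f v * X v = ∑ u : U, f u * x u := by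
        intro f
        rw [← Finset.sum_subset (Finset.subset_univ U) (by intro v _ hv; simp [X, hv]),
          ← Finset.sum_coe_sort U]
        exact Finset.sum_congr rfl fun u _ => by simp [X]
      have hy : ∀ u : U, (P *ᵥ X) u = (Q *ᵥ x) u := fun u => hX (P u)
      have e1 : x ⬝ᵥ (Q *ᵥ x) = X ⬝ᵥ (P *ᵥ X) := by
        rw [dotProduct_comm x, dotProduct_comm X]
        simp only [dotProduct]
        rw [hX]
        exact Finset.sum_congr rfl fun u _ => by rw [hy]
      have e2 : x ⬝ᵥ ((Q * Lap c' * Q) *ᵥ x) = (Q *ᵥ x) ⬝ᵥ (Lap c' *ᵥ (Q *ᵥ x)) := by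
        rw [Matrix.mul_assoc, ← mulVec_mulVec, ← mulVec_mulVec, dotProduct_mulVec x,
          ← mulVec_transpose, hQt]
      have e3 : X ⬝ᵥ (P *ᵥ X) = (P *ᵥ X) ⬝ᵥ (Lap c *ᵥ (P *ᵥ X)) := by
        conv_lhs => rw [← hPLP]
        rw [Matrix.mul_assoc, ← mulVec_mulVec, ← mulVec_mulVec, dotProduct_mulVec X,
          ← mulVec_transpose, hPt]
      rw [sub_mulVec, dotProduct_sub, e1, e2, e3, aux_quad c hsymm hd,
        aux_quad c' (fun i j => hsymm i j) (fun i => hd i), sub_nonneg]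
      refine mul_le_mul_of_nonneg_left ?_ (by norm_num)
      simp only [← hy]
      generalize P *ᵥ X = y
      have t : ∑ i : U, ∑ j : U, c' i j * (y i - y j) ^ 2
          = ∑ i ∈ U, ∑ j ∈ U, c i j * (y i - y j) ^ 2 := by
        rw [← Finset.sum_coe_sort U]
        refine Finset.sum_congr rfl fun i _ => ?_
        rw [← Finset.sum_coe_sort U]
      rw [t]
      have nn : ∀ i j, 0 ≤ c i j * (y i - y j) ^ 2 := fun i j => mul_nonneg (hn i j) (sq_nonneg _)
      calc _ ≤ ∑ i ∈ U, ∑ j, c i j * (y i - y j) ^ 2 :=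
            Finset.sum_le_sum fun i _ => Finset.sum_le_sum_of_subset_of_nonneg
              (Finset.subset_univ _) fun j _ _ => nn i j
        _ ≤ _ := Finset.sum_le_sum_of_subset_of_nonneg (Finset.subset_univ _)
              fun i _ _ => Finset.sum_nonneg fun j _ => nn i j
  have tr := aux_trace _ _ hAp hQ key
  have t1 : (Lap c' * Q).trace = ∑ i, ∑ j, Lap c' i j * Q i j := by
    simp only [trace, diag_apply, Matrix.mul_apply]
    refine Finset.sum_congr rfl fun i _ => Finset.sum_congr rfl fun j _ => ?_
    rw [← congrFun (congrFun hQt i) j, transpose_apply]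
  have t2 := aux_lap_sum c' (fun i j => hsymm i j) (fun i => hd i) (fun i j => Q i j)
  rw [t1.trans t2, Fintype.card_coe] at tr
  have t : ∑ i : U, ∑ j : U, c' i j * (Q i i + Q j j - Q i j - Q j i)
      = ∑ i ∈ U, ∑ j ∈ U, c i j * (P i i + P j j - P i j - P j i) := by
    rw [← Finset.sum_coe_sort U]
    refine Finset.sum_congr rfl fun i _ => ?_
    rw [← Finset.sum_coe_sort U]
    rfl
  rw [t] at tr
  linarith

lemma aux_forests {V : Type*} [Fintype V] [DecidableEq V] (G : SimpleGraph V) [DecidableRel G.Adj]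
    (k : ℕ) (hk : 0 < k)
    (hdeg : ∀ U : Finset V, U.Nonempty → ∃ v ∈ U, (U.filter (G.Adj v)).card ≤ k) :
    ∀ (n : ℕ) (U : Finset V), U.card = n → ∃ f : Sym2 V → Fin k, ∀ i : Fin k,
      (SimpleGraph.fromEdgeSet {e | e ∈ G.edgeSet ∧ (∀ x ∈ e, x ∈ U) ∧ f e = i}).IsAcyclic := by
  have : Nonempty (Fin k) := ⟨⟨0, hk⟩⟩
  intro n
  induction n with
  | zero =>
    intro U hU
    rw [Finset.card_eq_zero] at hU
    subst hU
    refine ⟨fun _ => Classical.arbitrary _, fun i => ?_⟩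
    refine SimpleGraph.isAcyclic_bot.anti ?_
    intro a b hab
    have := hab.1.2.1 a (Sym2.mem_mk_left a b)
    simp at this
  | succ n ih =>
    intro U hU
    obtain ⟨v, hv, hvk⟩ := hdeg U (Finset.card_pos.mp (by omega))
    obtain ⟨f, hf⟩ := ih (U.erase v) (by rw [Finset.card_erase_of_mem hv]; omega)
    obtain ⟨g, -, hg⟩ := Set.Finite.exists_injOn_of_encard_le
      (s := (↑(U.filter (G.Adj v)) : Set V)) (t := (Set.univ : Set (Fin k)))
      (Finset.finite_toSet _) (by
        rw [Set.encard_coe_eq_coe_finsetCard, Set.encard_univ]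
        simpa using hvk)
    classical
    let f' : Sym2 V → Fin k := fun e => if h : v ∈ e then g (Sym2.Mem.other h) else f e
    have hf'v : ∀ w, f' s(v, w) = g w := by
      intro w
      have h : v ∈ s(v, w) := Sym2.mem_mk_left v w
      have : Sym2.Mem.other h = w := Sym2.congr_right.mp (Sym2.other_spec h)
      simp only [f', h, dif_pos, this]
    have hf'n : ∀ a b, v ≠ a → v ≠ b → f' s(a, b) = f s(a, b) := by
      intro a b ha hb
      have h : v ∉ s(a, b) := by simp [ha, hb]
      simp only [f', h, dif_neg, not_false_eq_true]
    refine ⟨f', fun i => ?_⟩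
    set H := SimpleGraph.fromEdgeSet {e | e ∈ G.edgeSet ∧ (∀ x ∈ e, x ∈ U.erase v) ∧ f e = i}
      with hH
    have hHi : H.neighborSet v = ∅ := by
      ext w
      simp only [SimpleGraph.mem_neighborSet, Set.mem_empty_iff_false, iff_false]
      intro h
      have := h.1.2.1 v (Sym2.mem_mk_left v w)
      simp at this
    by_cases hw : ∃ w ∈ U.filter (G.Adj v), g w = i
    · obtain ⟨w, hw, hgw⟩ := hw
      have hvw : G.Adj v w := (Finset.mem_filter.mp hw).2
      refine ((hf i).sup_edge_of_not_reachable
        (SimpleGraph.not_reachable_of_neighborSet_left_eq_empty hvw.ne hHi)).anti ?_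
      have main : ∀ b, s(v, b) ∈ G.edgeSet → b ∈ U → f' s(v, b) = i → b = w := by
        intro b h1 h2 h3
        rw [hf'v] at h3
        exact hg (Finset.mem_coe.mpr (Finset.mem_filter.mpr ⟨h2, h1⟩)) hw (h3.trans hgw.symm)
      intro a b hab
      obtain ⟨⟨h1, h2, h3⟩, h4⟩ := hab
      have ha := h2 a (Sym2.mem_mk_left a b)
      have hb := h2 b (Sym2.mem_mk_right a b)
      rw [SimpleGraph.sup_adj]
      by_cases hva : v = a
      · subst hva
        right
        rw [main b h1 hb h3, SimpleGraph.edge_adj]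
        exact ⟨Or.inl ⟨rfl, rfl⟩, hvw.ne⟩
      by_cases hvb : v = b
      · subst hvb
        right
        rw [Sym2.eq_swap] at h1 h3
        rw [main a h1 ha h3, SimpleGraph.edge_adj]
        exact ⟨Or.inr ⟨rfl, rfl⟩, hvw.ne'⟩
      left
      rw [hf'n a b hva hvb] at h3
      refine ⟨⟨h1, ?_, h3⟩, h4⟩
      intro x hx
      rcases Sym2.mem_iff.mp hx with rfl | rfl
      · exact Finset.mem_erase.mpr ⟨Ne.symm hva, ha⟩
      · exact Finset.mem_erase.mpr ⟨Ne.symm hvb, hb⟩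
    · refine (hf i).anti ?_
      have main : ∀ b, s(v, b) ∈ G.edgeSet → b ∈ U → f' s(v, b) = i → False := by
        intro b h1 h2 h3
        rw [hf'v] at h3
        exact hw ⟨b, Finset.mem_filter.mpr ⟨h2, h1⟩, h3⟩
      intro a b hab
      obtain ⟨⟨h1, h2, h3⟩, h4⟩ := hab
      have ha := h2 a (Sym2.mem_mk_left a b)
      have hb := h2 b (Sym2.mem_mk_right a b)
      by_cases hva : v = a
      · subst hva
        exact (main b h1 hb h3).elim
      by_cases hvb : v = b
      · subst hvb
        rw [Sym2.eq_swap] at h1 h3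
        exact (main a h1 ha h3).elim
      rw [hf'n a b hva hvb] at h3
      refine ⟨⟨h1, ?_, h3⟩, h4⟩
      intro x hx
      rcases Sym2.mem_iff.mp hx with rfl | rfl
      · exact Finset.mem_erase.mpr ⟨Ne.symm hva, ha⟩
      · exact Finset.mem_erase.mpr ⟨Ne.symm hvb, hb⟩

/-- If every edge `e` of a connected weighted graph `G` satisfies `R_e(G) * c_e ≥ δ`
with `δ > 0`, then the arboricity of `G` is at most `2/δ`: its edges can be
partitioned into at most `⌈2/δ⌉` forests. -/
theorem stmt_15 {V : Type*} [Fintype V] [DecidableEq V]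
    (G : SimpleGraph V) (hconn : G.Connected)
    (c : V → V → ℝ) (hsymm : ∀ i j, c i j = c j i)
    (hpos : ∀ i j, G.Adj i j → 0 < c i j)
    (hzero : ∀ i j, ¬ G.Adj i j → c i j = 0)
    (P : Matrix V V ℝ) (hP : IsMoorePenrose (Lap c) P)
    (δ : ℝ) (hδ : 0 < δ)
    (hedge : ∀ i j, G.Adj i j → δ ≤ (chi i j ⬝ᵥ P.mulVec (chi i j)) * c i j) :
    DecomposesIntoForests G ⌈2 / δ⌉₊ := by
  classical
  have hd : ∀ i, c i i = 0 := fun i => hzero i i (G.loopless.irrefl i)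
  have hn : ∀ i j, 0 ≤ c i j := by
    intro i j
    by_cases h : G.Adj i j
    · exact (hpos i j h).le
    · rw [hzero i j h]
  have hk : 0 < ⌈2 / δ⌉₊ := Nat.ceil_pos.mpr (by positivity)
  obtain ⟨f, hf⟩ := aux_forests G ⌈2 / δ⌉₊ hk (by
    intro U hU
    by_contra hcon
    push Not at hcon
    have hF := aux_foster c hsymm hd hn P hP U
    have hlow : ∀ i ∈ U, (2 : ℝ) < ∑ j ∈ U, c i j * (P i i + P j j - P i j - P j i) := by
      intro i hi
      have h1 : 2 / δ < ((U.filter (G.Adj i)).card : ℝ) :=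
        (Nat.le_ceil _).trans_lt (by exact_mod_cast hcon i hi)
      rw [div_lt_iff₀ hδ] at h1
      refine h1.trans_le ?_
      rw [← Finset.sum_filter_add_sum_filter_not U (G.Adj i)]
      have z : ∑ j ∈ U.filter (fun j => ¬ G.Adj i j),
          c i j * (P i i + P j j - P i j - P j i) = 0 :=
        Finset.sum_eq_zero fun j hj => by
          rw [hzero i j (Finset.mem_filter.mp hj).2, zero_mul]
      rw [z, add_zero, ← nsmul_eq_mul]
      refine Finset.card_nsmul_le_sum _ _ _ fun j hj => ?_
      have hij := (Finset.mem_filter.mp hj).2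
      have := hedge i j hij
      rw [aux_chi P hij.ne] at this
      linarith
    have := Finset.sum_lt_sum_of_nonempty hU hlow
    rw [Finset.sum_const, nsmul_eq_mul] at this
    linarith) _ Finset.univ rfl
  refine ⟨f, fun i => ?_⟩
  simpa using hf i
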